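/- For every integer n ≥ 2, every integer k ≥ 1, and every integer r with 2 ≤ r ≤ n, one has p_{n,k+1,r} ≥ p_{n,k,r}. -/

import Mathlib

open Finset

/-- The number of lonely passengers: passenger `p` is lonely if no other
passenger chose the same bus. -/
def lonelyCount (n k : ℕ) (a : Fin n → Fin k) : ℕ :=
  (Finset.univ.filter fun p => ∀ q, q ≠ p → a q ≠ a p).card

/-- `pnk n k r` is the probability that at least `r` of the `n` passengers are
lonely when each of them independently chooses one of `k` buses uniformly at
random. -/
noncomputable def pnk (n k r : ℕ) : ℝ :=
  ((Finset.univ.filter fun a : Fin n → Fin k => r ≤ lonelyCount n k a).card : ℝ) /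
    ((k : ℝ) ^ n)

/-- The associated Stirling numbers of the second kind: the number of partitions of an `m`-element
set into `i` blocks, each of size at least two. -/
def assocStirling : ℕ → ℕ → ℕ
  | 0, 0 => 1
  | 0, _ + 1 => 0
  | 1, _ => 0
  | _ + 2, 0 => 0
  | m + 2, i + 1 => (i + 1) * assocStirling (m + 1) (i + 1) + (m + 1) * assocStirling m i

namespace assocStirling

lemma zero_succ (i : ℕ) : assocStirling 0 (i + 1) = 0 := by simp [assocStirling]

lemma one_left (i : ℕ) : assocStirling 1 i = 0 := by cases i <;> simp [assocStirling]

lemma succ_zero (m : ℕ) : assocStirling (m + 1) 0 = 0 := by cases m <;> simp [assocStirling]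

lemma succ_succ (m i : ℕ) : assocStirling (m + 2) (i + 1) =
    (i + 1) * assocStirling (m + 1) (i + 1) + (m + 1) * assocStirling m i := by
  simp [assocStirling]

lemma eq_zero_of_lt : ∀ (m i : ℕ), m < 2 * i → assocStirling m i = 0
  | 0, 0, h => by omega
  | 0, i + 1, _ => zero_succ i
  | 1, i, _ => one_left i
  | m + 2, 0, h => by omega
  | m + 2, i + 1, h => by
    rw [succ_succ, eq_zero_of_lt (m + 1) (i + 1) (by omega), eq_zero_of_lt m i (by omega)]
    simp

lemma pos : ∀ (m i : ℕ), 1 ≤ i → 2 * i ≤ m → 0 < assocStirling m i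
  | 0, i, h, h' => by omega
  | 1, i, h, h' => by omega
  | m + 2, 0, h, h' => by omega
  | 2, 1, _, _ => by simp [assocStirling]
  | 2, i + 2, _, h' => by omega
  | m + 3, 1, _, _ => by
    have := pos (m + 2) 1 le_rfl (by omega)
    rw [succ_succ]
    positivity
  | m + 3, i + 2, _, h' => by
    have := pos (m + 1) (i + 1) (by omega) (by omega)
    rw [succ_succ]
    positivity

/-- Sharp forms of log-concavity and interlacing for the rows of associated Stirling numbers,
which are stable under the recurrence. -/
lemma interlacing (m : ℕ) (hm : 2 ≤ m) :
    (∀ i, (i + 1) * assocStirling m (i + 1) * assocStirling (m + 1) i ≤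
      i * assocStirling m i * assocStirling (m + 1) (i + 1)) ∧
    (∀ i, (i + 2) * assocStirling (m + 1) (i + 2) * assocStirling m i ≤
      (i + 1) * assocStirling (m + 1) (i + 1) * assocStirling m (i + 1)) ∧
    (∀ i, (i + 2) ^ 2 * assocStirling m (i + 2) * assocStirling m i ≤
      (i + 1) ^ 2 * assocStirling m (i + 1) ^ 2) ∧
    (∀ i, (i + 2) ^ 2 * assocStirling (m + 1) (i + 2) * assocStirling (m + 1) i ≤
      (i + 1) ^ 2 * assocStirling (m + 1) (i + 1) ^ 2) := by
  induction m, hm using Nat.le_induction with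
  | base =>
    have h2 : ∀ i, assocStirling 2 (i + 2) = 0 := fun i => eq_zero_of_lt _ _ (by omega)
    have h3 : ∀ i, assocStirling 3 (i + 2) = 0 := fun i => eq_zero_of_lt _ _ (by omega)
    refine ⟨fun i => ?_, fun i => ?_, fun i => ?_, fun i => ?_⟩
    · cases i <;> simp [h2, succ_zero]
    all_goals simp [h2, h3]
  | succ m hm ih =>
    obtain ⟨hA, hB, hC, hC'⟩ := ih
    refine ⟨fun i => ?_, fun i => ?_, hC', fun i => ?_⟩
    · cases i with
      | zero => simp [succ_zero]
      | succ i =>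
        have := hB i
        rw [succ_succ, succ_succ]
        nlinarith
    · have h1 := hC' i
      have h2 := hA i
      rw [succ_succ, succ_succ]
      generalize assocStirling (m + 1) i = s0 at *
      generalize assocStirling (m + 1) (i + 1) = s1 at *
      generalize assocStirling (m + 1) (i + 2) = s2 at *
      generalize assocStirling m i = t0 at *
      generalize assocStirling m (i + 1) = t1 at *
      have h3 : (i + 2) * t1 * s0 ≤ (i + 1) * t0 * s1 := by
        have : t1 * s0 ≤ t0 * s1 := by
          by_contra! h
          have := Nat.mul_le_mul_left i h.le
          nlinarith
        nlinarith
      have h4 := Nat.mul_le_mul_left (m + 1) h3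
      nlinarith
    · cases i with
      | zero => simp [succ_zero]
      | succ i =>
        have c1 := hC' (i + 1)
        have c2 := hC i
        have a1 := hA (i + 1)
        have b1 := hB i
        have hz : assocStirling (m + 1) (i + 1) = 0 → assocStirling (m + 1) (i + 3) = 0 := by
          intro h
          by_contra h'
          have := mt (eq_zero_of_lt (m + 1) (i + 3)) h'
          exact (pos (m + 1) (i + 1) (by omega) (by omega)).ne' h
        rw [succ_succ, succ_succ, succ_succ]
        simp only [add_assoc, Nat.reduceAdd] at *
        generalize assocStirling (m + 1) (i + 1) = s0 at *
        generalize assocStirling (m + 1) (i + 2) = s1 at *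
        generalize assocStirling (m + 1) (i + 3) = s2 at *
        generalize assocStirling m i = t0 at *
        generalize assocStirling m (i + 1) = t1 at *
        generalize assocStirling m (i + 2) = t2 at *
        have e1 : (i + 3) ^ 2 * ((i + 3) * s2 * ((i + 1) * s0)) ≤
            (i + 2) ^ 2 * ((i + 2) * s1) ^ 2 := by
          have h : (i + 3) * (i + 1) ≤ (i + 2) ^ 2 := by nlinarith
          calc _ = ((i + 3) * (i + 1)) * ((i + 3) ^ 2 * s2 * s0) := by ring
            _ ≤ (i + 2) ^ 2 * ((i + 2) ^ 2 * s1 ^ 2) := Nat.mul_le_mul h c1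
            _ = _ := by ring
        have e2 : (i + 3) ^ 2 * (t2 * t0) ≤ (i + 2) ^ 2 * t1 ^ 2 := by
          have h : ((i + 3) * (i + 1)) ^ 2 ≤ ((i + 2) ^ 2) ^ 2 :=
            Nat.pow_le_pow_left (by nlinarith) 2
          refine le_of_mul_le_mul_left (a := (i + 2) ^ 2) ?_ (by positivity)
          calc _ = (i + 3) ^ 2 * ((i + 2) ^ 2 * t2 * t0) := by ring
            _ ≤ (i + 3) ^ 2 * ((i + 1) ^ 2 * t1 ^ 2) := Nat.mul_le_mul_left _ c2
            _ = ((i + 3) * (i + 1)) ^ 2 * t1 ^ 2 := by ring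
            _ ≤ ((i + 2) ^ 2) ^ 2 * t1 ^ 2 := Nat.mul_le_mul_right _ h
            _ = _ := by ring
        have e3 : (i + 3) ^ 2 * ((i + 1) * s0 * t2) ≤ (i + 2) ^ 3 * (s1 * t1) := by
          have h : ((i + 3) * (i + 1)) ^ 2 ≤ ((i + 2) ^ 2) ^ 2 :=
            Nat.pow_le_pow_left (by nlinarith) 2
          refine le_of_mul_le_mul_left (a := i + 2) ?_ (by positivity)
          calc _ = (i + 3) ^ 2 * (i + 1) * ((i + 2) * t2 * s0) := by ring
            _ ≤ (i + 3) ^ 2 * (i + 1) * ((i + 1) * t1 * s1) := Nat.mul_le_mul_left _ a1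
            _ = ((i + 3) * (i + 1)) ^ 2 * (t1 * s1) := by ring
            _ ≤ ((i + 2) ^ 2) ^ 2 * (t1 * s1) := Nat.mul_le_mul_right _ h
            _ = _ := by ring
        have e4 : (i + 3) ^ 3 * (s2 * t0) ≤ (i + 2) ^ 3 * (s1 * t1) := by
          rcases Nat.eq_zero_or_pos s0 with h0 | h0
          · simp [hz h0]
          have h : (i + 3) * (i + 1) ≤ (i + 2) ^ 2 := by nlinarith
          refine le_of_mul_le_mul_left (a := s0) ?_ h0
          calc _ = (i + 3) * t0 * ((i + 3) ^ 2 * s2 * s0) := by ring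
            _ ≤ (i + 3) * t0 * ((i + 2) ^ 2 * s1 ^ 2) := Nat.mul_le_mul_left _ c1
            _ = (i + 3) * (i + 2) * s1 * ((i + 2) * s1 * t0) := by ring
            _ ≤ (i + 3) * (i + 2) * s1 * ((i + 1) * s0 * t1) := Nat.mul_le_mul_left _ b1
            _ = (i + 3) * (i + 1) * ((i + 2) * s0 * s1 * t1) := by ring
            _ ≤ (i + 2) ^ 2 * ((i + 2) * s0 * s1 * t1) := Nat.mul_le_mul_right _ h
            _ = _ := by ring
        have e2' := Nat.mul_le_mul_left ((m + 1) ^ 2) e2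
        have e3' := Nat.mul_le_mul_left (m + 1) e3
        have e4' := Nat.mul_le_mul_left (m + 1) e4
        linarith

lemma mul_le_mul_adjacent {m : ℕ} (hm : 2 ≤ m) (i : ℕ) :
    assocStirling (m + 1) (i + 2) * assocStirling m i ≤
      assocStirling m (i + 1) * assocStirling (m + 1) (i + 1) := by
  have h := (interlacing m hm).2.1 i
  by_contra! h'
  nlinarith

lemma mul_le_mul_row {m : ℕ} (hm : 2 ≤ m) (i e : ℕ) :
    assocStirling (m + 1) (i + 1 + e) * assocStirling m i ≤
      assocStirling m (i + e) * assocStirling (m + 1) (i + 1) := by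
  induction e with
  | zero => simp [mul_comm]
  | succ e ih =>
    rcases Nat.eq_zero_or_pos i with rfl | hi
    · obtain ⟨m, rfl⟩ := Nat.exists_eq_add_of_le' (show 1 ≤ m by omega)
      simp [succ_zero]
    by_cases h : 2 * (i + e) ≤ m
    · refine le_of_mul_le_mul_left (a := assocStirling m (i + e)) ?_ (pos _ _ (by omega) h)
      have h1 := mul_le_mul_adjacent hm (i + e)
      rw [show i + 1 + e = i + e + 1 by ring] at ih
      rw [show i + 1 + (e + 1) = i + e + 2 by ring, show i + (e + 1) = i + e + 1 by ring]
      calc _ = assocStirling (m + 1) (i + e + 2) * assocStirling m (i + e) *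
            assocStirling m i := by ring
        _ ≤ _ := Nat.mul_le_mul_right _ h1
        _ = assocStirling m (i + e + 1) *
            (assocStirling (m + 1) (i + e + 1) * assocStirling m i) := by ring
        _ ≤ _ := Nat.mul_le_mul_left _ ih
        _ = _ := by ring
    · rw [eq_zero_of_lt (m + 1) (i + 1 + (e + 1)) (by omega)]
      simp

lemma mul_le_mul {m : ℕ} (hm : 2 ≤ m) (i d e : ℕ) :
    assocStirling (m + d) (i + d + e) * assocStirling m i ≤
      assocStirling m (i + e) * assocStirling (m + d) (i + d) := by
  induction d with
  | zero => simp
  | succ d ih =>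
    rcases Nat.eq_zero_or_pos i with rfl | hi
    · obtain ⟨m, rfl⟩ := Nat.exists_eq_add_of_le' (show 1 ≤ m by omega)
      simp [succ_zero]
    by_cases h : 2 * (i + d) ≤ m + d
    · refine le_of_mul_le_mul_left (a := assocStirling (m + d) (i + d)) ?_
        (pos _ _ (by omega) h)
      have h1 := mul_le_mul_row (show 2 ≤ m + d by omega) (i + d) e
      rw [← add_assoc, ← add_assoc]
      calc _ = assocStirling (m + d + 1) (i + d + 1 + e) * assocStirling (m + d) (i + d) *
            assocStirling m i := by ring
        _ ≤ _ := Nat.mul_le_mul_right _ h1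
        _ = assocStirling (m + d + 1) (i + d + 1) *
            (assocStirling (m + d) (i + d + e) * assocStirling m i) := by ring
        _ ≤ _ := Nat.mul_le_mul_left _ ih
        _ = _ := by ring
    · rw [eq_zero_of_lt (m + (d + 1)) (i + (d + 1) + e) (by omega)]
      simp

end assocStirling

/-- The number of partitions of an `n`-element set into `s` blocks, exactly `j` of which are
singletons. -/
def singletonPartitions (n s j : ℕ) : ℕ :=
  if j ≤ s then n.choose j * assocStirling (n - j) (s - j) else 0

lemma singletonPartitions_mul_le {n s t i j : ℕ} (hst : s ≤ t) (hij : i ≤ j) :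
    singletonPartitions n t i * singletonPartitions n s j ≤
      singletonPartitions n t j * singletonPartitions n s i := by
  by_cases hjs : j ≤ s
  swap
  · simp [singletonPartitions, hjs]
  by_cases hjn : j ≤ n
  swap
  · simp [singletonPartitions, Nat.choose_eq_zero_of_lt (not_le.1 hjn)]
  simp only [singletonPartitions, hjs, hjs.trans hst, hij.trans hjs, hij.trans (hjs.trans hst),
    if_true]
  obtain ⟨d, rfl⟩ := Nat.exists_eq_add_of_le hij
  obtain ⟨x, rfl⟩ := Nat.exists_eq_add_of_le hjs
  obtain ⟨e, rfl⟩ := Nat.exists_eq_add_of_le hst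
  obtain ⟨m, rfl⟩ := Nat.exists_eq_add_of_le hjn
  rw [show i + d + m - i = m + d by omega, show i + d + x + e - i = x + d + e by omega,
    show i + d + m - (i + d) = m by omega, show i + d + x - (i + d) = x by omega,
    show i + d + x + e - (i + d) = x + e by omega, show i + d + x - i = x + d by omega]
  suffices h : assocStirling (m + d) (x + d + e) * assocStirling m x ≤
      assocStirling m (x + e) * assocStirling (m + d) (x + d) by
    calc _ = (i + d + m).choose i * (i + d + m).choose (i + d) *
          (assocStirling (m + d) (x + d + e) * assocStirling m x) := by ring
      _ ≤ _ := Nat.mul_le_mul_left _ h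
      _ = _ := by ring
  match m, x, e with
  | 0, 0, 0 => simp [mul_comm]
  | 0, 0, e + 1 =>
    rw [assocStirling.eq_zero_of_lt (0 + d) (0 + d + (e + 1)) (by omega)]
    simp
  | 0, x + 1, _ => simp [assocStirling.zero_succ]
  | 1, _, _ => simp [assocStirling.one_left]
  | m + 2, x, e => exact assocStirling.mul_le_mul (by omega) x d e

/-- The basic composition inequality for `2 × 2` minors. -/
lemma sum_mul_sum_le_of_ratio_mono (N : ℕ) (a b c d : ℕ → ℕ)
    (hab : ∀ i j, i ≤ j → a i * b j ≤ a j * b i)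
    (hcd : ∀ i j, i ≤ j → c i * d j ≤ c j * d i) :
    (∑ i ∈ range N, a i * d i) * (∑ j ∈ range N, b j * c j) ≤
      (∑ i ∈ range N, a i * c i) * (∑ j ∈ range N, b j * d j) := by
  have key : ∀ i j, (a i * b j * (d i * c j) + a j * b i * (d j * c i) : ℕ) ≤
      a i * b j * (c i * d j) + a j * b i * (c j * d i) := by
    have aux : ∀ i j, i ≤ j → (a i * b j * (d i * c j) + a j * b i * (d j * c i) : ℕ) ≤
        a i * b j * (c i * d j) + a j * b i * (c j * d i) := by
      intro i j hij
      have h1 := hab i j hij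
      have h2 := hcd i j hij
      zify at h1 h2 ⊢
      nlinarith [mul_nonneg (sub_nonneg.2 h1) (sub_nonneg.2 h2)]
    intro i j
    rcases le_total i j with h | h
    · exact aux i j h
    · have := aux j i h
      linarith
  have h := sum_le_sum fun i (_ : i ∈ range N) => sum_le_sum fun j (_ : j ∈ range N) => key i j
  simp only [sum_add_distrib] at h
  rw [sum_comm (f := fun i j => a j * b i * (d j * c i)),
    sum_comm (f := fun i j => a j * b i * (c j * d i))] at h
  rw [sum_mul_sum, sum_mul_sum]
  calc _ = ∑ i ∈ range N, ∑ j ∈ range N, a i * b j * (d i * c j) :=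
        sum_congr rfl fun i _ => sum_congr rfl fun j _ => by ring
    _ ≤ ∑ i ∈ range N, ∑ j ∈ range N, a i * b j * (c i * d j) := by linarith
    _ = _ := sum_congr rfl fun i _ => sum_congr rfl fun j _ => by ring

section Count

variable {n k : ℕ}

/-- The number of passengers on bus `b`. -/
def load (a : Fin n → Fin k) (b : Fin k) : ℕ := #{p | a p = b}

/-- The number of buses carrying exactly one passenger. -/
def singleCount (a : Fin n → Fin k) : ℕ := #{b | load a b = 1}

/-- The number of buses carrying at least two passengers. -/
def crowdedCount (a : Fin n → Fin k) : ℕ := #{b | 2 ≤ load a b}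

lemma lonelyCount_eq_singleCount (a : Fin n → Fin k) :
    lonelyCount n k a = singleCount a := by
  rw [lonelyCount, singleCount]
  refine card_bij (fun p _ => a p) ?_ ?_ ?_
  · intro p hp
    simp only [mem_filter, mem_univ, true_and] at hp
    simp only [mem_filter, mem_univ, true_and]
    rw [load]
    refine card_eq_one.2 ⟨p, ?_⟩
    ext q
    simp only [mem_filter, mem_univ, true_and, mem_singleton]
    exact ⟨fun h => by_contra fun hne => hp q hne h, fun h => by rw [h]⟩
  · intro p hp q _ h
    simp only [mem_filter, mem_univ, true_and] at hp
    by_contra hne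
    exact hp q (Ne.symm hne) h.symm
  · intro b hb
    simp only [mem_filter, mem_univ, true_and] at hb
    rw [load] at hb
    obtain ⟨p, hp⟩ := card_eq_one.1 hb
    have hmem : ∀ q, a q = b ↔ q = p := fun q => by
      simpa using congrArg (q ∈ ·) hp
    have hpb : a p = b := (hmem p).2 rfl
    refine ⟨p, ?_, hpb⟩
    simp only [mem_filter, mem_univ, true_and]
    intro q hq h
    exact hq ((hmem q).1 (h.trans hpb))

lemma load_cons (x : Fin k) (a : Fin n → Fin k) (b : Fin k) :
    load (Fin.cons x a : Fin (n + 1) → Fin k) b = (if x = b then 1 else 0) + load a b := by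
  simp only [load, card_filter, Fin.sum_univ_succ, Fin.cons_zero, Fin.cons_succ]

lemma counts_cons_of_load_eq_zero {x : Fin k} {a : Fin n → Fin k} (h : load a x = 0) :
    singleCount (Fin.cons x a : Fin (n + 1) → Fin k) = singleCount a + 1 ∧
      crowdedCount (Fin.cons x a : Fin (n + 1) → Fin k) = crowdedCount a := by
  constructor
  · rw [singleCount, singleCount, ← card_insert_of_notMem (a := x) (by simp [h])]
    congr 1
    ext b
    by_cases hb : x = b
    · subst hb; simp [load_cons, h]
    · simp [load_cons, hb, Ne.symm hb]
  · rw [crowdedCount, crowdedCount]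
    congr 1
    ext b
    by_cases hb : x = b
    · subst hb; simp [load_cons, h]
    · simp [load_cons, hb]

lemma counts_cons_of_load_eq_one {x : Fin k} {a : Fin n → Fin k} (h : load a x = 1) :
    singleCount (Fin.cons x a : Fin (n + 1) → Fin k) + 1 = singleCount a ∧
      crowdedCount (Fin.cons x a : Fin (n + 1) → Fin k) = crowdedCount a + 1 := by
  constructor
  · rw [singleCount, singleCount, ← card_insert_of_notMem (a := x) (by simp [load_cons, h])]
    congr 1
    ext b
    by_cases hb : x = b
    · subst hb; simp [h]
    · simp [load_cons, hb, Ne.symm hb]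
  · rw [crowdedCount, crowdedCount, ← card_insert_of_notMem (a := x) (by simp [h])]
    congr 1
    ext b
    by_cases hb : x = b
    · subst hb; simp [load_cons, h]
    · simp [load_cons, hb, Ne.symm hb]

lemma counts_cons_of_two_le_load {x : Fin k} {a : Fin n → Fin k} (h : 2 ≤ load a x) :
    singleCount (Fin.cons x a : Fin (n + 1) → Fin k) = singleCount a ∧
      crowdedCount (Fin.cons x a : Fin (n + 1) → Fin k) = crowdedCount a := by
  constructor
  · rw [singleCount, singleCount]
    congr 1
    ext b
    by_cases hb : x = b
    · subst hb
      simp only [load_cons, mem_filter, mem_univ, true_and, if_true]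
      omega
    · simp [load_cons, hb]
  · rw [crowdedCount, crowdedCount]
    congr 1
    ext b
    by_cases hb : x = b
    · subst hb
      simp only [load_cons, mem_filter, mem_univ, true_and, if_true]
      omega
    · simp [load_cons, hb]

lemma card_load_eq_zero (a : Fin n → Fin k) :
    #{b | load a b = 0} + singleCount a + crowdedCount a = k := by
  simp only [singleCount, crowdedCount, card_filter, ← sum_add_distrib]
  rw [sum_congr rfl (g := fun _ => 1) fun b _ => by split_ifs <;> omega]
  simp

/-- The effect of one more passenger on the numbers of single and crowded buses. -/
lemma sum_cons_counts (a : Fin n → Fin k) (f : ℕ → ℕ → ℕ) :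
    ∑ x, f (singleCount (Fin.cons x a : Fin (n + 1) → Fin k))
        (crowdedCount (Fin.cons x a : Fin (n + 1) → Fin k)) =
      (k - (singleCount a + crowdedCount a)) * f (singleCount a + 1) (crowdedCount a) +
      singleCount a * f (singleCount a - 1) (crowdedCount a + 1) +
      crowdedCount a * f (singleCount a) (crowdedCount a) := by
  have hk := card_load_eq_zero a
  rw [show k - (singleCount a + crowdedCount a) = #{b | load a b = 0} by omega]
  conv_rhs =>
    rw [show ∀ u v w : ℕ, #{b | load a b = 0} * u + singleCount a * v + crowdedCount a * w =
      ∑ b, ((if load a b = 0 then u else 0) + (if load a b = 1 then v else 0) +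
        (if 2 ≤ load a b then w else 0)) from fun u v w => by
        simp [sum_add_distrib, ← sum_filter, singleCount, crowdedCount]]
  refine sum_congr rfl fun x _ => ?_
  rcases Nat.lt_or_ge (load a x) 2 with h | h
  · rcases Nat.le_one_iff_eq_zero_or_eq_one.1 (Nat.le_of_lt_succ h) with h | h
    · obtain ⟨h1, h2⟩ := counts_cons_of_load_eq_zero h
      simp [h1, h2, h]
    · obtain ⟨h1, h2⟩ := counts_cons_of_load_eq_one h
      simp [← h1, h2, h]
  · obtain ⟨h1, h2⟩ := counts_cons_of_two_le_load h
    simp [h1, h2, h, show load a x ≠ 0 by omega, show load a x ≠ 1 by omega]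

lemma card_counts_succ (n k j i : ℕ) :
    #{a : Fin (n + 1) → Fin k | singleCount a = j ∧ crowdedCount a = i} =
      ∑ a : Fin n → Fin k,
        ((k - (singleCount a + crowdedCount a)) *
          (if singleCount a + 1 = j ∧ crowdedCount a = i then 1 else 0) +
        singleCount a * (if singleCount a - 1 = j ∧ crowdedCount a + 1 = i then 1 else 0) +
        crowdedCount a * (if singleCount a = j ∧ crowdedCount a = i then 1 else 0)) := by
  rw [card_filter, ← (Fin.consEquiv fun _ : Fin (n + 1) => Fin k).sum_comp, Fintype.sum_prod_type,
    sum_comm]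
  refine sum_congr rfl fun a _ => ?_
  exact sum_cons_counts a fun u v => if u = j ∧ v = i then 1 else 0

lemma choose_mul_assocStirling_zero (n j : ℕ) :
    n.choose j * assocStirling (n + 1 - j) 0 = 0 := by
  rcases Nat.lt_or_ge n j with h | h
  · rw [Nat.choose_eq_zero_of_lt h, zero_mul]
  · rw [Nat.sub_add_comm h, assocStirling.succ_zero, mul_zero]

lemma choose_mul_assocStirling_succ (n j i : ℕ) :
    n.choose j * assocStirling (n + 1 - j) (i + 1) =
      (j + 1) * (n.choose (j + 1) * assocStirling (n - (j + 1)) i) +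
        (i + 1) * (n.choose j * assocStirling (n - j) (i + 1)) := by
  rcases Nat.lt_or_ge n j with h | h
  · rw [Nat.choose_eq_zero_of_lt h, Nat.choose_eq_zero_of_lt (show n < j + 1 by omega)]
    simp
  obtain ⟨m, rfl⟩ := Nat.exists_eq_add_of_le h
  have hc : (j + m).choose (j + 1) * (j + 1) = (j + m).choose j * m := by
    have := Nat.choose_succ_right_eq (j + m) j
    rwa [show j + m - j = m by omega] at this
  rw [show j + m + 1 - j = m + 1 by omega, show j + m - j = m by omega,
    show j + m - (j + 1) = m - 1 by omega]
  rcases m with _ | m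
  · simp [assocStirling.one_left, assocStirling.zero_succ]
  · rw [assocStirling.succ_succ, Nat.add_sub_cancel, ← mul_assoc (j + 1), mul_comm (j + 1), hc]
    ring

lemma card_counts (n k j i : ℕ) :
    #{a : Fin n → Fin k | singleCount a = j ∧ crowdedCount a = i} =
      k.descFactorial (j + i) * (n.choose j * assocStirling (n - j) i) := by
  induction n generalizing j i with
  | zero =>
    have h0 : ∀ a : Fin 0 → Fin k, singleCount a = 0 ∧ crowdedCount a = 0 := fun a => by
      simp [singleCount, crowdedCount, load]
    rcases j with _ | j <;> rcases i with _ | i <;>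
      simp [h0, assocStirling]
  | succ n ih =>
    have h1 : ∀ j i, ∑ a : Fin n → Fin k, (k - (singleCount a + crowdedCount a)) *
        (if singleCount a + 1 = j + 1 ∧ crowdedCount a = i then 1 else 0) =
        (k - (j + i)) * (k.descFactorial (j + i) *
          (n.choose j * assocStirling (n - j) i)) := by
      intro j i
      simp only [← ih, card_filter, mul_sum, Nat.add_right_cancel_iff]
      refine sum_congr rfl fun a _ => ?_
      split_ifs with h
      · rw [h.1, h.2]
      · simp
    have h2 : ∀ j i, ∑ a : Fin n → Fin k, singleCount a *
        (if singleCount a - 1 = j ∧ crowdedCount a + 1 = i + 1 then 1 else 0) =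
        (j + 1) * (k.descFactorial (j + 1 + i) *
          (n.choose (j + 1) * assocStirling (n - (j + 1)) i)) := by
      intro j i
      simp only [← ih, card_filter, mul_sum]
      refine sum_congr rfl fun a _ => ?_
      rcases singleCount a with _ | s
      · simp
      · simp only [Nat.add_right_cancel_iff, Nat.add_sub_cancel]
        split_ifs with h
        · rw [h.1]
        · simp
    have h3 : ∀ j i, ∑ a : Fin n → Fin k, crowdedCount a *
        (if singleCount a = j ∧ crowdedCount a = i then 1 else 0) =
        i * (k.descFactorial (j + i) * (n.choose j * assocStirling (n - j) i)) := by
      intro j i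
      simp only [← ih, card_filter, mul_sum]
      refine sum_congr rfl fun a _ => ?_
      split_ifs with h
      · rw [h.2]
      · simp
    have h23 : ∑ a : Fin n → Fin k, singleCount a *
          (if singleCount a - 1 = j ∧ crowdedCount a + 1 = i then 1 else 0) +
        ∑ a : Fin n → Fin k, crowdedCount a *
          (if singleCount a = j ∧ crowdedCount a = i then 1 else 0) =
        k.descFactorial (j + i) * (n.choose j * assocStirling (n + 1 - j) i) := by
      rw [h3]
      rcases i with _ | i
      · rw [choose_mul_assocStirling_zero]
        simp
      · rw [h2, choose_mul_assocStirling_succ, show j + 1 + i = j + (i + 1) by ring]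
        ring
    rw [card_counts_succ, sum_add_distrib, sum_add_distrib, add_assoc, h23]
    rcases j with _ | j
    · simp
    · rw [h1, Nat.choose_succ_succ, show n + 1 - (j + 1) = n - j by omega,
        show j + 1 + i = j + i + 1 by ring, Nat.descFactorial_succ]
      ring

lemma singleCount_add_crowdedCount_le (a : Fin n → Fin k) :
    singleCount a + crowdedCount a ≤ k := by
  have := card_load_eq_zero a
  omega

/-- Counting assignments by the number of occupied buses and the number of lonely passengers. -/
lemma card_le_lonelyCount (n k r N : ℕ) (hN : k < N) :
    #{a : Fin n → Fin k | r ≤ lonelyCount n k a} =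
      ∑ s ∈ range N, k.descFactorial s *
        ∑ j ∈ range N, singletonPartitions n s j * (if r ≤ j then 1 else 0) := by
  have hc : ∀ s j, #{a : Fin n → Fin k | singleCount a + crowdedCount a = s ∧
      singleCount a = j} = k.descFactorial s * singletonPartitions n s j := by
    intro s j
    by_cases hjs : j ≤ s
    · obtain ⟨i, rfl⟩ := Nat.exists_eq_add_of_le hjs
      rw [singletonPartitions, if_pos hjs, Nat.add_sub_cancel_left, ← card_counts]
      congr 1
      ext a
      simp only [mem_filter, mem_univ, true_and]
      omega
    · rw [singletonPartitions, if_neg hjs, mul_zero, card_eq_zero, filter_eq_empty_iff]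
      intro a _
      omega
  simp only [mul_sum, ← mul_assoc, ← hc, lonelyCount_eq_singleCount, card_filter, sum_mul]
  symm
  rw [sum_congr rfl fun s _ => sum_comm, sum_comm]
  refine sum_congr rfl fun a _ => ?_
  rw [← sum_product']
  have := singleCount_add_crowdedCount_le a
  rw [sum_eq_single (singleCount a + crowdedCount a, singleCount a)]
  · simp
  · rintro ⟨s, j⟩ _ hne
    simp only [ne_eq, Prod.mk.injEq] at hne
    rw [if_neg (by tauto), zero_mul]
  · intro h
    simp only [mem_product, mem_range] at h
    omega

end Count

lemma descFactorial_mul_succ_le (k : ℕ) {s t : ℕ} (h : s ≤ t) :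
    (k + 1).descFactorial s * k.descFactorial t ≤
      (k + 1).descFactorial t * k.descFactorial s := by
  induction t, h using Nat.le_induction with
  | base => exact le_rfl
  | succ t _ ih =>
    rw [Nat.descFactorial_succ, Nat.descFactorial_succ]
    calc _ = (k - t) * ((k + 1).descFactorial s * k.descFactorial t) := by ring
      _ ≤ (k + 1 - t) * ((k + 1).descFactorial t * k.descFactorial s) :=
        Nat.mul_le_mul (by omega) ih
      _ = _ := by ring

/-- For every `n ≥ 2`, `k ≥ 1` and `2 ≤ r ≤ n`, one has
`p_{n,k+1,r} ≥ p_{n,k,r}`. -/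
theorem lonely_prob_mono_of_two_le (n k r : ℕ) (hn : 2 ≤ n) (hk : 1 ≤ k)
    (hr2 : 2 ≤ r) (hrn : r ≤ n) :
    pnk n k r ≤ pnk n (k + 1) r := by
  have hpow : ∀ l, l < k + 2 → l ^ n = ∑ s ∈ range (k + 2), l.descFactorial s *
      ∑ j ∈ range (k + 2), singletonPartitions n s j * 1 := by
    intro l hl
    have := card_le_lonelyCount n l 0 (k + 2) hl
    simpa using this
  have hmain := sum_mul_sum_le_of_ratio_mono (k + 2) (k + 1).descFactorial k.descFactorial
    (fun s => ∑ j ∈ range (k + 2), singletonPartitions n s j * (if r ≤ j then 1 else 0))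
    (fun s => ∑ j ∈ range (k + 2), singletonPartitions n s j * 1)
    (fun s t h => descFactorial_mul_succ_le k h) fun s t hst => by
      have := sum_mul_sum_le_of_ratio_mono (k + 2) (singletonPartitions n t)
        (singletonPartitions n s) (fun j => if r ≤ j then 1 else 0) (fun _ => 1)
        (fun i j hij => singletonPartitions_mul_le hst hij)
        (fun i j hij => by split_ifs <;> omega)
      linarith
  rw [← hpow _ (by omega), ← hpow _ (by omega), ← card_le_lonelyCount n _ r _ (by omega),
    ← card_le_lonelyCount n _ r _ (by omega)] at hmain
  rw [pnk, pnk, div_le_div_iff₀ (by positivity) (by positivity)]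
  rw [mul_comm]
  exact_mod_cast hmain
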